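/- A Hopf algebra H over a field k is co-Frobenius if and only if its coradical filtration is finite, i.e., H = H_n for some n. -/

import Mathlib

/-!
STATEMENT 0: A Hopf algebra `H` over a field `k` is co-Frobenius (it admits a nonzero
left integral) if and only if its coradical filtration is finite, i.e. `H = Hₙ` for some `n`.
-/

open TensorProduct

noncomputable section

universe u

variable (k : Type u) [Field k] (H : Type u) [Ring H] [HopfAlgebra k H]

/-- A submodule `C ⊆ H` is a subcoalgebra if `Δ(C) ⊆ C ⊗ C` (as a subspace of `H ⊗ H`). -/
def IsSubcoalgebra (C : Submodule k H) : Prop :=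
  ∀ x ∈ C, Coalgebra.comul (R := k) x ∈ LinearMap.range (TensorProduct.map C.subtype C.subtype)

/-- A simple subcoalgebra: a nonzero subcoalgebra containing no nonzero proper subcoalgebra. -/
def IsSimpleSubcoalgebra (C : Submodule k H) : Prop :=
  C ≠ ⊥ ∧ IsSubcoalgebra k H C ∧
    ∀ D : Submodule k H, D ≤ C → IsSubcoalgebra k H D → D = ⊥ ∨ D = C

/-- The coradical `H₀` of `H`: the sum of all simple subcoalgebras of `H`. -/
def coradical : Submodule k H :=
  sSup {C : Submodule k H | IsSimpleSubcoalgebra k H C}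

/-- The coradical filtration of `H`:
`H₀` is the coradical and `H_{n+1} = Δ⁻¹(H ⊗ Hₙ + H₀ ⊗ H)`. -/
def coradFilt : ℕ → Submodule k H
  | 0 => coradical k H
  | n + 1 =>
      Submodule.comap (Coalgebra.comul (R := k) (A := H))
        (LinearMap.range (LinearMap.lTensor H (coradFilt n).subtype) ⊔
          LinearMap.range (LinearMap.rTensor H (coradical k H).subtype))

/-- `H` is co-Frobenius: it admits a nonzero left integral, i.e. a nonzero linear
functional `∫ : H → k` with `∫(h₍₂₎) h₍₁₎ = ∫(h) 1_H` for all `h ∈ H`. -/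
def IsCoFrobenius : Prop :=
  ∃ I : H →ₗ[k] k, I ≠ 0 ∧ ∀ h : H,
    (TensorProduct.rid k H) ((LinearMap.lTensor H I) (Coalgebra.comul (R := k) h)) =
      I h • (1 : H)

section Actions

variable {k H}

open Coalgebra LinearMap

/-- The operator `h ↦ h₍₁₎ a(h₍₂₎)` on `H` attached to a functional `a`. -/
def rightAct (a : H →ₗ[k] k) : H →ₗ[k] H :=
  (TensorProduct.rid k H).toLinearMap ∘ₗ lTensor H a ∘ₗ comul

/-- The operator `h ↦ a(h₍₁₎) h₍₂₎` on `H` attached to a functional `a`. -/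
def leftAct (a : H →ₗ[k] k) : H →ₗ[k] H :=
  (TensorProduct.lid k H).toLinearMap ∘ₗ rTensor H a ∘ₗ comul

theorem rightAct_apply (a : H →ₗ[k] k) (h : H) :
    rightAct a h = TensorProduct.rid k H (lTensor H a (comul h)) := rfl

theorem leftAct_apply (a : H →ₗ[k] k) (h : H) :
    leftAct a h = TensorProduct.lid k H (rTensor H a (comul h)) := rfl

theorem rightAct_of_comul {ι : Type*} {s : Finset ι} {x y : ι → H} {h : H}
    (hh : comul (R := k) h = ∑ i ∈ s, x i ⊗ₜ[k] y i) (a : H →ₗ[k] k) :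
    rightAct a h = ∑ i ∈ s, a (y i) • x i := by
  simp [rightAct_apply, hh]

theorem leftAct_of_comul {ι : Type*} {s : Finset ι} {x y : ι → H} {h : H}
    (hh : comul (R := k) h = ∑ i ∈ s, x i ⊗ₜ[k] y i) (a : H →ₗ[k] k) :
    leftAct a h = ∑ i ∈ s, a (x i) • y i := by
  simp [leftAct_apply, hh]

theorem rightAct_counit (h : H) : rightAct (counit (R := k)) h = h := by
  simp [rightAct_apply]

theorem leftAct_counit (h : H) : leftAct (counit (R := k)) h = h := by
  simp [leftAct_apply]

theorem counit_rightAct (a : H →ₗ[k] k) (h : H) : counit (R := k) (rightAct a h) = a h := by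
  have key : ∀ t : H ⊗[k] H, counit (R := k) (TensorProduct.rid k H (lTensor H a t)) =
      a (TensorProduct.lid k H (rTensor H (counit (R := k)) t)) := by
    intro t
    induction t with
    | zero => simp
    | tmul x y => simp [mul_comm]
    | add x y hx hy => simp only [map_add, hx, hy]
  rw [rightAct_apply, key, ← leftAct_apply, leftAct_counit]

theorem counit_leftAct (a : H →ₗ[k] k) (h : H) : counit (R := k) (leftAct a h) = a h := by
  have key : ∀ t : H ⊗[k] H, counit (R := k) (TensorProduct.lid k H (rTensor H a t)) =
      a (TensorProduct.rid k H (lTensor H (counit (R := k)) t)) := by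
    intro t
    induction t with
    | zero => simp
    | tmul x y => simp [mul_comm]
    | add x y hx hy => simp only [map_add, hx, hy]
  rw [leftAct_apply, key, ← rightAct_apply, rightAct_counit]

theorem comul_rightAct (a : H →ₗ[k] k) (h : H) :
    comul (R := k) (rightAct a h) = lTensor H (rightAct a) (comul h) := by
  have key : ∀ t : H ⊗[k] H, comul (R := k) (TensorProduct.rid k H (lTensor H a t)) =
      lTensor H ((TensorProduct.rid k H).toLinearMap ∘ₗ lTensor H a)
        (TensorProduct.assoc k H H H (rTensor H comul t)) := by
    intro t
    induction t with
    | zero => simp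
    | tmul x y =>
      simp only [lTensor_tmul, rid_tmul, map_smul, rTensor_tmul]
      induction comul (R := k) x with
      | zero => simp
      | tmul x₁ x₂ => simp
      | add x y hx hy => simp only [map_add, smul_add, hx, hy, add_tmul]
    | add x y hx hy => simp only [map_add, hx, hy]
  rw [rightAct_apply, key, coassoc_apply, ← LinearMap.comp_apply, ← lTensor_comp]
  rfl

theorem comul_leftAct (a : H →ₗ[k] k) (h : H) :
    comul (R := k) (leftAct a h) = rTensor H (leftAct a) (comul h) := by
  have key : ∀ t : H ⊗[k] H, comul (R := k) (TensorProduct.lid k H (rTensor H a t)) =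
      rTensor H ((TensorProduct.lid k H).toLinearMap ∘ₗ rTensor H a)
        ((TensorProduct.assoc k H H H).symm (lTensor H comul t)) := by
    intro t
    induction t with
    | zero => simp
    | tmul x y =>
      simp only [lTensor_tmul, lid_tmul, map_smul, rTensor_tmul]
      induction comul (R := k) y with
      | zero => simp
      | tmul x₁ x₂ => simp [smul_tmul']
      | add x y hx hy => simp only [map_add, smul_add, hx, hy, tmul_add]
    | add x y hx hy => simp only [map_add, hx, hy]
  rw [leftAct_apply, key, coassoc_symm_apply, ← LinearMap.comp_apply, ← rTensor_comp]
  rfl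

theorem rightAct_rightAct (a b : H →ₗ[k] k) (h : H) :
    rightAct a (rightAct b h) = rightAct (a ∘ₗ rightAct b) h := by
  rw [rightAct_apply, comul_rightAct, ← LinearMap.comp_apply, ← lTensor_comp, rightAct_apply]

theorem leftAct_leftAct (a b : H →ₗ[k] k) (h : H) :
    leftAct a (leftAct b h) = leftAct (a ∘ₗ leftAct b) h := by
  rw [leftAct_apply, comul_leftAct, ← LinearMap.comp_apply, ← rTensor_comp, leftAct_apply]

theorem leftAct_rightAct (a b : H →ₗ[k] k) (h : H) :
    leftAct a (rightAct b h) = rightAct b (leftAct a h) := by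
  have key : ∀ t : H ⊗[k] H, TensorProduct.lid k H (rTensor H a (lTensor H (rightAct b) t)) =
      rightAct b (TensorProduct.lid k H (rTensor H a t)) := by
    intro t
    induction t with
    | zero => simp
    | tmul x y => simp
    | add x y hx hy => simp only [map_add, hx, hy]
  rw [leftAct_apply, comul_rightAct, key, ← leftAct_apply]

theorem tensor_eq_of_left_functionals {M N : Type*} [AddCommGroup M] [Module k M]
    [AddCommGroup N] [Module k N] {t t' : M ⊗[k] N}
    (h : ∀ a : M →ₗ[k] k, TensorProduct.lid k N (rTensor N a t) =
      TensorProduct.lid k N (rTensor N a t')) : t = t' := by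
  classical
  let b := Module.Basis.ofVectorSpace k M
  apply (TensorProduct.equivFinsuppOfBasisLeft (N := N) b).injective
  ext i
  rw [TensorProduct.equivFinsuppOfBasisLeft_apply, TensorProduct.equivFinsuppOfBasisLeft_apply, h]

theorem tensor_eq_of_right_functionals {M N : Type*} [AddCommGroup M] [Module k M]
    [AddCommGroup N] [Module k N] {t t' : M ⊗[k] N}
    (h : ∀ a : N →ₗ[k] k, TensorProduct.rid k M (lTensor M a t) =
      TensorProduct.rid k M (lTensor M a t')) : t = t' := by
  classical
  let b := Module.Basis.ofVectorSpace k N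
  apply (TensorProduct.equivFinsuppOfBasisRight (M := M) b).injective
  ext i
  rw [TensorProduct.equivFinsuppOfBasisRight_apply, TensorProduct.equivFinsuppOfBasisRight_apply, h]

theorem finiteDimensional_range_leftAct (h : H) :
    ∃ F : Submodule k H, FiniteDimensional k F ∧ ∀ a : H →ₗ[k] k, leftAct a h ∈ F := by
  let R := ℛ k h
  refine ⟨Submodule.span k (Set.range fun i : R.index => R.right i),
    FiniteDimensional.span_of_finite k (Set.finite_range _), fun a => ?_⟩
  rw [leftAct_of_comul R.eq.symm]
  exact Submodule.sum_mem _ fun i hi =>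
    Submodule.smul_mem _ _ (Submodule.subset_span ⟨⟨i, hi⟩, rfl⟩)

end Actions

section Corepresentations

variable {k H}

open Coalgebra LinearMap Matrix

variable {ι κ ζ : Type*} [Fintype ι] [Fintype κ] [Fintype ζ] [DecidableEq ι] [DecidableEq κ]
  [DecidableEq ζ]

/-- A multiplicative matrix: the matrix of coefficients of a finite-dimensional comodule. -/
structure IsCorep (k : Type u) [Field k] {H : Type u} [Ring H] [HopfAlgebra k H] {ι : Type*}
    [Fintype ι] [DecidableEq ι] (c : Matrix ι ι H) : Prop where
  comul_apply : ∀ i j, comul (R := k) (c i j) = ∑ l, c i l ⊗ₜ[k] c l j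
  counit_apply : ∀ i j, counit (R := k) (c i j) = (1 : Matrix ι ι k) i j

namespace IsCorep

variable {c : Matrix ι ι H}

theorem map_counit (hc : IsCorep k c) : c.map (counit (R := k)) = 1 := by
  ext i j; simp [hc.counit_apply]

theorem rightAct_apply (hc : IsCorep k c) (a : H →ₗ[k] k) (i j : ι) :
    rightAct a (c i j) = ∑ l, a (c l j) • c i l :=
  rightAct_of_comul (hc.comul_apply i j) a

theorem leftAct_apply (hc : IsCorep k c) (a : H →ₗ[k] k) (i j : ι) :
    leftAct a (c i j) = ∑ l, a (c i l) • c l j :=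
  leftAct_of_comul (hc.comul_apply i j) a

theorem map_comp_rightAct (hc : IsCorep k c) (a b : H →ₗ[k] k) :
    c.map (a ∘ₗ rightAct b) = c.map a * c.map b := by
  ext i j
  simp [hc.rightAct_apply, Matrix.mul_apply, mul_comm]

theorem mul_antipode (hc : IsCorep k c) : c * c.map (HopfAlgebra.antipode k) = 1 := by
  ext i j
  have h := HopfAlgebra.mul_antipode_lTensor_comul_apply (R := k) (c i j)
  rw [hc.comul_apply, hc.counit_apply] at h
  simp only [map_sum, lTensor_tmul, LinearMap.mul'_apply] at h
  simp only [Matrix.mul_apply, Matrix.map_apply, h]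
  by_cases hij : i = j <;> simp [hij, Matrix.one_apply]

theorem antipode_mul (hc : IsCorep k c) : c.map (HopfAlgebra.antipode k) * c = 1 := by
  ext i j
  have h := HopfAlgebra.mul_antipode_rTensor_comul_apply (R := k) (c i j)
  rw [hc.comul_apply, hc.counit_apply] at h
  simp only [map_sum, rTensor_tmul, LinearMap.mul'_apply] at h
  simp only [Matrix.mul_apply, Matrix.map_apply, h]
  by_cases hij : i = j <;> simp [hij, Matrix.one_apply]

theorem map_comul (hc : IsCorep k c) : c.map (Bialgebra.comulAlgHom k H) =
    c.map (Algebra.TensorProduct.includeLeft (R := k) (S := k) (A := H) (B := H)) *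
      c.map (Algebra.TensorProduct.includeRight (R := k) (A := H) (B := H)) := by
  ext i j
  simp [Matrix.mul_apply, hc.comul_apply]

theorem map_comul_antipode (hc : IsCorep k c) :
    (c.map (HopfAlgebra.antipode k)).map (Bialgebra.comulAlgHom k H) =
    (c.map (HopfAlgebra.antipode k)).map
      (Algebra.TensorProduct.includeRight (R := k) (A := H) (B := H)) *
    (c.map (HopfAlgebra.antipode k)).map
      (Algebra.TensorProduct.includeLeft (R := k) (S := k) (A := H) (B := H)) := by
  apply left_inv_eq_right_inv (a := c.map (Bialgebra.comulAlgHom k H))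
  · rw [← Matrix.map_mul, hc.antipode_mul, Matrix.map_one _ (map_zero _) (map_one _)]
  · have hL : ∀ f : H →ₐ[k] H ⊗[k] H,
        c.map f * (c.map (HopfAlgebra.antipode k)).map f = 1 := fun f => by
      rw [← Matrix.map_mul, hc.mul_antipode, Matrix.map_one _ (map_zero _) (map_one _)]
    rw [hc.map_comul, Matrix.mul_assoc,
      ← Matrix.mul_assoc (c.map (Algebra.TensorProduct.includeRight (R := k) (A := H) (B := H))),
      hL, Matrix.one_mul, hL]

theorem comul_antipode (hc : IsCorep k c) (i j : ι) :
    comul (R := k) (HopfAlgebra.antipode k (c i j)) =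
      ∑ l, HopfAlgebra.antipode k (c l j) ⊗ₜ[k] HopfAlgebra.antipode k (c i l) := by
  have h := congrFun (congrFun hc.map_comul_antipode i) j
  simpa [Matrix.mul_apply] using h

theorem antipode_transpose (hc : IsCorep k c) :
    IsCorep k (c.map (HopfAlgebra.antipode k))ᵀ where
  comul_apply i j := by simpa using hc.comul_antipode j i
  counit_apply i j := by
    simp only [transpose_apply, Matrix.map_apply, HopfAlgebra.counit_antipode, hc.counit_apply]
    simp [Matrix.one_apply, eq_comm]

theorem kronecker {u : Matrix κ κ H} (hu : IsCorep k u) (hc : IsCorep k c) :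
    IsCorep k (Matrix.kroneckerMap (· * ·) u c) where
  comul_apply := by
    rintro ⟨j, a⟩ ⟨i, b⟩
    simp [hu.comul_apply, hc.comul_apply, Finset.sum_mul_sum, Fintype.sum_prod_type]
  counit_apply := by
    rintro ⟨j, a⟩ ⟨i, b⟩
    simp only [kroneckerMap_apply, Bialgebra.counit_mul, hu.counit_apply, hc.counit_apply,
      Matrix.one_apply, Prod.mk.injEq]
    by_cases h₁ : j = i <;> by_cases h₂ : a = b <;> simp [h₁, h₂]

end IsCorep

/-- The matrix `z s S(c)` over `H` attached to a scalar matrix `s` and two comodules `z`, `c`. -/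
def conjMatrix (z : Matrix ζ ζ H) (c : Matrix ι ι H) (s : Matrix ζ ι k) : Matrix ζ ι H :=
  z * s.map (algebraMap k H) * c.map (HopfAlgebra.antipode k)

theorem conjMatrix_rightAct {z : Matrix ζ ζ H} {c : Matrix ι ι H} (hz : IsCorep k z)
    (hc : IsCorep k c) (s : Matrix ζ ι k) (r : H →ₗ[k] k) :
    (conjMatrix z c s).map (rightAct r) * c =
      z * ((conjMatrix z c s).map r).map (algebraMap k H) := by
  set B := conjMatrix z c s with hB
  let L := Algebra.TensorProduct.includeLeft (R := k) (S := k) (A := H) (B := H)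
  let R := Algebra.TensorProduct.includeRight (R := k) (A := H) (B := H)
  let D := Bialgebra.comulAlgHom k H
  have hs : (s.map (algebraMap k H)).map D = (s.map (algebraMap k H)).map R := by
    ext i j
    simp only [Matrix.map_apply, AlgHom.commutes]
  have h : B.map D = z.map L * B.map R * (c.map (HopfAlgebra.antipode k)).map L := by
    rw [hB, conjMatrix, Matrix.map_mul, Matrix.map_mul, hs, hz.map_comul, hc.map_comul_antipode,
      Matrix.map_mul, Matrix.map_mul]
    simp only [Matrix.mul_assoc, L, R]
  have h' : B.map (rightAct r) =
      z * (B.map r).map (algebraMap k H) * c.map (HopfAlgebra.antipode k) := by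
    ext i j
    have hij : comul (R := k) (B i j) = ∑ p : ι × ζ,
        (z i p.2 * HopfAlgebra.antipode k (c p.1 j)) ⊗ₜ[k] B p.2 p.1 := by
      have := congrFun (congrFun h i) j
      simpa [Matrix.mul_apply, D, L, R, Finset.sum_mul, Fintype.sum_prod_type] using this
    rw [Matrix.map_apply, rightAct_of_comul hij]
    simp [Matrix.mul_apply, Finset.sum_mul, Fintype.sum_prod_type, Algebra.smul_def,
      Algebra.commutes, mul_assoc]
  rw [h', Matrix.mul_assoc, hc.antipode_mul, Matrix.mul_one]

/-- A finite-dimensional left coideal has a matrix of coefficients. -/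
theorem exists_isCorep_of_leftAct_mem (W : Submodule k H) [FiniteDimensional k W]
    (hW : ∀ a : H →ₗ[k] k, ∀ w ∈ W, leftAct a w ∈ W) :
    ∃ c : Matrix (Fin (Module.finrank k W)) (Fin (Module.finrank k W)) H, IsCorep k c ∧
      ∀ i, comul (R := k) (Module.finBasis k W i : H) =
        ∑ j, c i j ⊗ₜ[k] (Module.finBasis k W j : H) := by
  let w := Module.finBasis k W
  choose ω hω using fun j => LinearMap.exists_extend (w.coord j)
  have hω' : ∀ j (x : W), ω j x = w.coord j x := fun j x =>
    LinearMap.congr_fun (hω j) x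
  let c : Matrix (Fin (Module.finrank k W)) (Fin (Module.finrank k W)) H :=
    fun i j => rightAct (ω j) (w i)
  have hp : ∀ x ∈ W, ∑ j, ω j x • (w j : H) = x := fun x hx => by
    have := congrArg W.subtype (w.sum_repr ⟨x, hx⟩)
    simp only [map_sum, map_smul, Submodule.subtype_apply] at this
    simpa only [hω' _ ⟨x, hx⟩, Module.Basis.coord_apply] using this
  have hcomul : ∀ i, comul (R := k) (w i : H) = ∑ j, c i j ⊗ₜ[k] (w j : H) := by
    intro i
    apply tensor_eq_of_left_functionals
    intro a
    rw [← leftAct_apply, ← hp _ (hW a _ (w i).2)]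
    simp only [map_sum, rTensor_tmul, lid_tmul, c]
    refine Finset.sum_congr rfl fun j _ => ?_
    congr 1
    rw [← counit_leftAct (a), leftAct_rightAct, counit_rightAct]
  refine ⟨c, ⟨fun i j => ?_, fun i j => ?_⟩, hcomul⟩
  · rw [comul_rightAct, hcomul]
    simp only [map_sum, lTensor_tmul, c]
  · simp only [c, counit_rightAct, hω' j (w i), Module.Basis.coord_apply, w.repr_self,
      Matrix.one_apply, Finsupp.single_apply]

theorem exists_isCorep_mem_span (h : H) : ∃ (n : ℕ) (c : Matrix (Fin n) (Fin n) H), IsCorep k c ∧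
    h ∈ Submodule.span k (Set.range fun p : Fin n × Fin n => c p.1 p.2) := by
  obtain ⟨F, hF, hFm⟩ := finiteDimensional_range_leftAct (k := k) h
  let e : (H →ₗ[k] k) →ₗ[k] H :=
    { toFun := fun a => leftAct a h
      map_add' := fun a b => by simp [leftAct_apply, rTensor_add]
      map_smul' := fun a b => by simp [leftAct_apply, rTensor_smul] }
  let W := LinearMap.range e
  have hWF : W ≤ F := by rintro _ ⟨a, rfl⟩; exact hFm a
  have : FiniteDimensional k W := Submodule.finiteDimensional_of_le hWF
  obtain ⟨c, hc, hcw⟩ := exists_isCorep_of_leftAct_mem W (by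
    rintro a _ ⟨b, rfl⟩
    exact ⟨a ∘ₗ leftAct b, (leftAct_leftAct a b h).symm⟩)
  refine ⟨_, c, hc, ?_⟩
  have hh : h ∈ W := ⟨counit, leftAct_counit h⟩
  have := congrArg W.subtype ((Module.finBasis k W).sum_repr ⟨h, hh⟩)
  simp only [map_sum, map_smul, Submodule.subtype_apply] at this
  rw [← this]
  refine Submodule.sum_mem _ fun i _ => Submodule.smul_mem _ _ ?_
  rw [← rightAct_counit (k := k) (Module.finBasis k W i : H), rightAct_of_comul (hcw i)]
  exact Submodule.sum_mem _ fun j _ =>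
    Submodule.smul_mem _ _ (Submodule.subset_span ⟨(i, j), rfl⟩)

end Corepresentations

section Subcoalgebras

variable {k H}

open Coalgebra LinearMap

theorem isSubcoalgebra_iff {C : Submodule k H} : IsSubcoalgebra k H C ↔
    ∀ a : H →ₗ[k] k, ∀ x ∈ C, rightAct a x ∈ C ∧ leftAct a x ∈ C := by
  refine ⟨fun hC a x hx => ?_, fun hC x hx => ?_⟩
  · obtain ⟨t, ht⟩ := hC x hx
    rw [rightAct_apply, leftAct_apply, ← ht]
    clear ht
    induction t with
    | zero => simp
    | tmul y z =>
      simp only [map_tmul, lTensor_tmul, rTensor_tmul, rid_tmul, lid_tmul]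
      exact ⟨C.smul_mem _ y.2, C.smul_mem _ z.2⟩
    | add t t' ht ht' =>
      simp only [map_add]
      exact ⟨C.add_mem ht.1 ht'.1, C.add_mem ht.2 ht'.2⟩
  · obtain ⟨p, hp⟩ := C.subtype.exists_leftInverse_of_injective (Submodule.ker_subtype C)
    let P : H →ₗ[k] H := C.subtype ∘ₗ p
    have hP : ∀ y ∈ C, P y = y := fun y hy =>
      congrArg C.subtype (LinearMap.congr_fun hp ⟨y, hy⟩)
    have h₁ : lTensor H P (comul (R := k) x) = comul x := by
      apply tensor_eq_of_left_functionals
      intro a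
      have key : ∀ t : H ⊗[k] H, TensorProduct.lid k H (rTensor H a (lTensor H P t)) =
          P (TensorProduct.lid k H (rTensor H a t)) := by
        intro t
        induction t with
        | zero => simp
        | tmul x y => simp
        | add x y hx hy => simp only [map_add, hx, hy]
      rw [key, ← leftAct_apply, hP _ (hC a x hx).2]
    have h₂ : rTensor H P (comul (R := k) x) = comul x := by
      apply tensor_eq_of_right_functionals
      intro a
      have key : ∀ t : H ⊗[k] H, TensorProduct.rid k H (lTensor H a (rTensor H P t)) =
          P (TensorProduct.rid k H (lTensor H a t)) := by
        intro t
        induction t with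
        | zero => simp
        | tmul x y => simp
        | add x y hx hy => simp only [map_add, hx, hy]
      rw [key, ← rightAct_apply, hP _ (hC a x hx).1]
    refine ⟨TensorProduct.map p p (comul x), ?_⟩
    rw [← LinearMap.comp_apply, ← TensorProduct.map_comp, ← LinearMap.lTensor_comp_rTensor,
      LinearMap.comp_apply]
    change lTensor H P (rTensor H P _) = _
    rw [h₂, h₁]

theorem IsSubcoalgebra.rightAct_mem {C : Submodule k H} (hC : IsSubcoalgebra k H C)
    (a : H →ₗ[k] k) {x : H} (hx : x ∈ C) : rightAct a x ∈ C :=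
  (isSubcoalgebra_iff.1 hC a x hx).1

theorem IsSubcoalgebra.leftAct_mem {C : Submodule k H} (hC : IsSubcoalgebra k H C)
    (a : H →ₗ[k] k) {x : H} (hx : x ∈ C) : leftAct a x ∈ C :=
  (isSubcoalgebra_iff.1 hC a x hx).2

theorem IsSubcoalgebra.inf {C D : Submodule k H} (hC : IsSubcoalgebra k H C)
    (hD : IsSubcoalgebra k H D) : IsSubcoalgebra k H (C ⊓ D) :=
  isSubcoalgebra_iff.2 fun a _ hx => ⟨⟨hC.rightAct_mem a hx.1, hD.rightAct_mem a hx.2⟩,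
    ⟨hC.leftAct_mem a hx.1, hD.leftAct_mem a hx.2⟩⟩

theorem isSubcoalgebra_sSup {S : Set (Submodule k H)} (hS : ∀ C ∈ S, IsSubcoalgebra k H C) :
    IsSubcoalgebra k H (sSup S) := by
  rw [isSubcoalgebra_iff]
  intro a x hx
  suffices h : sSup S ≤ (sSup S).comap (rightAct a) ⊓ (sSup S).comap (leftAct a) from h hx
  exact sSup_le fun C hC y hy => ⟨le_sSup hC ((hS C hC).rightAct_mem a hy),
    le_sSup hC ((hS C hC).leftAct_mem a hy)⟩

theorem IsSubcoalgebra.sup {C D : Submodule k H} (hC : IsSubcoalgebra k H C)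
    (hD : IsSubcoalgebra k H D) : IsSubcoalgebra k H (C ⊔ D) := by
  rw [← sSup_pair]
  exact isSubcoalgebra_sSup (by rintro _ (rfl | rfl) <;> assumption)

theorem IsCorep.isSubcoalgebra_span {n : ℕ} {c : Matrix (Fin n) (Fin n) H} (hc : IsCorep k c) :
    IsSubcoalgebra k H (Submodule.span k (Set.range fun p : Fin n × Fin n => c p.1 p.2)) := by
  rw [isSubcoalgebra_iff]
  intro a x hx
  set E := Submodule.span k (Set.range fun p : Fin n × Fin n => c p.1 p.2)
  have hE : ∀ i j, c i j ∈ E := fun i j => Submodule.subset_span ⟨(i, j), rfl⟩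
  suffices h : E ≤ E.comap (rightAct a) ⊓ E.comap (leftAct a) from h hx
  refine Submodule.span_le.2 ?_
  rintro _ ⟨⟨i, j⟩, rfl⟩
  simp only [Submodule.coe_inf, Set.mem_inter_iff, SetLike.mem_coe, Submodule.mem_comap,
    hc.rightAct_apply, hc.leftAct_apply]
  exact ⟨E.sum_mem fun l _ => E.smul_mem _ (hE _ _), E.sum_mem fun l _ => E.smul_mem _ (hE _ _)⟩

theorem IsSimpleSubcoalgebra.finiteDimensional {C : Submodule k H}
    (hC : IsSimpleSubcoalgebra k H C) : FiniteDimensional k C := by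
  obtain ⟨y, hy, hy0⟩ := C.exists_mem_ne_zero_of_ne_bot hC.1
  obtain ⟨n, c, hc, hyc⟩ := exists_isCorep_mem_span (k := k) y
  set E := Submodule.span k (Set.range fun p : Fin n × Fin n => c p.1 p.2)
  have hE : FiniteDimensional k E := FiniteDimensional.span_of_finite k (Set.finite_range _)
  rcases hC.2.2 (C ⊓ E) inf_le_left (hC.2.1.inf hc.isSubcoalgebra_span) with h | h
  · exact absurd ((Submodule.eq_bot_iff _).1 h y ⟨hy, hyc⟩) hy0
  · exact Submodule.finiteDimensional_of_le (inf_eq_left.1 h)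

theorem mem_coradFilt_succ {n : ℕ} {h : H} (hh : ∀ a b : H →ₗ[k] k,
    (∀ x ∈ coradical k H, a x = 0) → (∀ x ∈ coradFilt k H n, b x = 0) → a (rightAct b h) = 0) :
    h ∈ coradFilt k H (n + 1) := by
  have hker := TensorProduct.map_ker
    (LinearMap.exact_subtype_mkQ (coradical k H)) (Submodule.mkQ_surjective _)
    (LinearMap.exact_subtype_mkQ (coradFilt k H n)) (Submodule.mkQ_surjective _)
  rw [coradFilt, Submodule.mem_comap, ← hker, LinearMap.mem_ker]
  apply tensor_eq_of_right_functionals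
  intro b
  rw [map_zero, map_zero, ← Module.forall_dual_apply_eq_zero_iff k]
  intro a
  have key : ∀ t : H ⊗[k] H, a (TensorProduct.rid k _ (lTensor _ b
      (TensorProduct.map (coradical k H).mkQ (coradFilt k H n).mkQ t))) =
      (a ∘ₗ (coradical k H).mkQ) (TensorProduct.rid k H
        (lTensor H (b ∘ₗ (coradFilt k H n).mkQ) t)) := by
    intro t
    induction t with
    | zero => simp
    | tmul x y => simp
    | add x y hx hy => simp only [map_add, hx, hy]
  rw [key]
  refine hh _ _ (fun x hx => ?_) fun x hx => ?_
  · simp [(Submodule.Quotient.mk_eq_zero _).2 hx]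
  · simp [(Submodule.Quotient.mk_eq_zero _).2 hx]

theorem rightAct_mem_coradical {n : ℕ} {g : H →ₗ[k] k} (hg : ∀ x ∈ coradFilt k H n, g x = 0)
    {h : H} (hh : h ∈ coradFilt k H (n + 1)) : rightAct g h ∈ coradical k H := by
  rw [rightAct_apply]
  rw [coradFilt, Submodule.mem_comap] at hh
  suffices hle : range (lTensor H (coradFilt k H n).subtype) ⊔
      range (rTensor H (coradical k H).subtype) ≤
      (coradical k H).comap ((TensorProduct.rid k H).toLinearMap ∘ₗ lTensor H g) from hle hh
  refine sup_le ?_ ?_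
  · rintro _ ⟨t, rfl⟩
    induction t with
    | zero => simp
    | tmul x y => simp [hg _ y.2]
    | add x y hx hy => rw [map_add]; exact Submodule.add_mem _ hx hy
  · rintro _ ⟨t, rfl⟩
    induction t with
    | zero => simp
    | tmul x y => simpa using Submodule.smul_mem _ _ x.2
    | add x y hx hy => rw [map_add]; exact Submodule.add_mem _ hx hy

end Subcoalgebras

section FiniteFiltration

variable {k H}

open Coalgebra LinearMap

theorem rightAct_sub (a b : H →ₗ[k] k) (h : H) :
    rightAct (a - b) h = rightAct a h - rightAct b h := by
  simp [rightAct_apply, lTensor_sub]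

theorem IsSubcoalgebra.rightAct_eq_zero {C : Submodule k H} (hC : IsSubcoalgebra k H C)
    {a : H →ₗ[k] k} (ha : ∀ x ∈ C, a x = 0) {x : H} (hx : x ∈ C) : rightAct a x = 0 := by
  obtain ⟨t, ht⟩ := hC x hx
  rw [rightAct_apply, ← ht]
  clear ht
  induction t with
  | zero => simp
  | tmul y z => simp [ha _ z.2]
  | add t t' ht ht' => simp only [map_add, ht, ht', add_zero]

theorem exists_rightAct_mem_coradical {n : ℕ} (hn : coradFilt k H n = ⊤) :
    ∃ g : H →ₗ[k] k, g ≠ 0 ∧ ∀ h, rightAct g h ∈ coradical k H := by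
  induction n with
  | zero =>
    refine ⟨counit, fun h => ?_, fun h => ?_⟩
    · simpa using LinearMap.congr_fun h 1
    · rw [rightAct_counit]
      change h ∈ coradFilt k H 0
      simp [hn]
  | succ n ih =>
    by_cases h : coradFilt k H n = ⊤
    · exact ih h
    · obtain ⟨g, hg, hle⟩ := Submodule.exists_le_ker_of_lt_top _ (lt_top_iff_ne_top.2 h)
      exact ⟨g, hg, fun x => rightAct_mem_coradical (fun y hy => hle hy) (by simp [hn])⟩

/-- Any nonzero element of the coradical survives in the projection onto some simple summand. -/
theorem exists_isCompl_simple {y : H} (hy : y ∈ coradical k H) (hy0 : y ≠ 0) :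
    ∃ K C : Submodule k H, IsSubcoalgebra k H K ∧ IsSimpleSubcoalgebra k H C ∧ y ∉ K ∧
      C ⊓ K = ⊥ ∧ coradical k H ≤ K ⊔ C := by
  obtain ⟨K, -, hK⟩ := zorn_le_nonempty₀ {K : Submodule k H | IsSubcoalgebra k H K ∧ y ∉ K}
    (fun c hc hchain z hz => ⟨sSup c, ⟨isSubcoalgebra_sSup fun C hC => (hc hC).1, fun hyc => by
      obtain ⟨C, hC, hyC⟩ := (Submodule.mem_sSup_of_directed ⟨z, hz⟩ hchain.directedOn).1 hyc
      exact (hc hC).2 hyC⟩, fun C hC => le_sSup hC⟩) ⊥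
    ⟨by simpa using isSubcoalgebra_sSup (k := k) (H := H) (S := ∅) (by simp), by simpa using hy0⟩
  have hmax : ∀ C, IsSubcoalgebra k H C → ¬ C ≤ K → y ∈ K ⊔ C := fun C hC hCK => by
    by_contra hyC
    exact hCK (le_sup_right.trans (hK.2 ⟨hK.1.1.sup hC, hyC⟩ le_sup_left))
  obtain ⟨C, hC, hCK⟩ : ∃ C, IsSimpleSubcoalgebra k H C ∧ ¬ C ≤ K := by
    by_contra! hcon
    exact hK.1.2 (sSup_le (fun C hC => hcon C hC) hy)
  refine ⟨K, C, hK.1.1, hC, hK.1.2, ?_, sSup_le fun C' hC' => ?_⟩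
  · exact (hC.2.2 _ inf_le_left (hC.2.1.inf hK.1.1)).resolve_right fun h => hCK (inf_eq_left.1 h)
  · by_cases hC'K : C' ≤ K
    · exact hC'K.trans le_sup_left
    · refine inf_eq_left.1 ((hC'.2.2 (C' ⊓ (K ⊔ C)) inf_le_left
        (hC'.2.1.inf (hK.1.1.sup hC.2.1))).resolve_left fun h => hK.1.2 ?_)
      have : (K ⊔ C') ⊓ (K ⊔ C) = K := by
        rw [sup_inf_assoc_of_le C' (le_sup_left : K ≤ K ⊔ C), h, sup_bot_eq]
      exact this ▸ ⟨hmax C' hC'.2.1 hC'K, hmax C hC.2.1 hCK⟩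

theorem exists_finiteDimensional_range_rightAct {n : ℕ} (hn : coradFilt k H n = ⊤) :
    ∃ f : H →ₗ[k] k, rightAct f ≠ 0 ∧ FiniteDimensional k (range (rightAct f)) := by
  obtain ⟨g, hg, hgH⟩ := exists_rightAct_mem_coradical hn
  obtain ⟨h, hh⟩ : ∃ h, g h ≠ 0 := by
    by_contra! hcon
    exact hg (LinearMap.ext hcon)
  have hy0 : rightAct g h ≠ 0 := fun h0 => hh (by rw [← counit_rightAct, h0, map_zero])
  obtain ⟨K, C, hK, hC, hyK, hCK, hle⟩ := exists_isCompl_simple (hgH h) hy0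
  have hker : ker (K.mkQ ∘ₗ C.subtype) = ⊥ := by
    rw [ker_comp, Submodule.ker_mkQ, Submodule.eq_bot_iff]
    intro x hx
    have : (x : H) ∈ C ⊓ K := ⟨x.2, hx⟩
    simpa [hCK] using this
  obtain ⟨p, hp⟩ := (K.mkQ ∘ₗ C.subtype).exists_leftInverse_of_injective hker
  let e : H →ₗ[k] k := counit ∘ₗ C.subtype ∘ₗ p ∘ₗ K.mkQ
  have heC : ∀ x ∈ C, (e - counit : H →ₗ[k] k) x = 0 := fun x hx => by
    have : p (K.mkQ x) = ⟨x, hx⟩ := LinearMap.congr_fun hp ⟨x, hx⟩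
    rw [LinearMap.sub_apply, sub_eq_zero]
    change counit (C.subtype (p (K.mkQ x))) = _
    rw [this, Submodule.subtype_apply]
  have heK : ∀ x ∈ K, e x = 0 := fun x hx => by
    simp [e, (Submodule.Quotient.mk_eq_zero _).2 hx]
  have key : ∀ x ∈ K ⊔ C, rightAct e x ∈ C ∧ (rightAct e x = 0 → x ∈ K) := by
    intro x hx
    obtain ⟨a, ha, b, hb, rfl⟩ := Submodule.mem_sup.1 hx
    have hb' : rightAct e b = b := by
      have := hC.2.1.rightAct_eq_zero heC hb
      rwa [rightAct_sub, rightAct_counit, sub_eq_zero] at this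
    rw [map_add, hK.rightAct_eq_zero heK ha, hb', zero_add]
    exact ⟨hb, fun h => by simpa [h] using ha⟩
  have hfd := hC.finiteDimensional
  refine ⟨e ∘ₗ rightAct g, fun h0 => hyK ((key _ (hle (hgH h))).2 ?_),
    Submodule.finiteDimensional_of_le (S₂ := C) ?_⟩
  · rw [rightAct_rightAct, h0, LinearMap.zero_apply]
  · rintro _ ⟨x, rfl⟩
    rw [← rightAct_rightAct]
    exact (key _ (hle (hgH x))).1

theorem isCoFrobenius_of_corep {ι : Type*} [Fintype ι] [DecidableEq ι] {u : Matrix ι ι H}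
    (hu : IsCorep k u) {r : ι → H →ₗ[k] k}
    (hr : ∀ j h, rightAct (r j) h = ∑ i, r i h • u i j) (hr0 : r ≠ 0) : IsCoFrobenius k H := by
  let S := HopfAlgebra.antipode k (A := H)
  let s : ι → ι → H := fun i j => S (u i j)
  let d : ι → ι → H := fun i j => S (s i j)
  have hus : ∀ i j, ∑ l, u i l * s l j = (1 : Matrix ι ι H) i j := fun i j => by
    rw [← hu.mul_antipode, Matrix.mul_apply]; rfl
  have hsu : ∀ i j, ∑ l, s i l * u l j = (1 : Matrix ι ι H) i j := fun i j => by
    rw [← hu.antipode_mul, Matrix.mul_apply]; rfl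
  have hS : ∀ i j, S ((1 : Matrix ι ι H) i j) = (1 : Matrix ι ι H) i j := fun i j => by
    by_cases hij : i = j <;> simp [hij, S, Matrix.one_apply]
  have hds : ∀ i j, ∑ l, d l j * s i l = (1 : Matrix ι ι H) i j := fun i j => by
    rw [← hS, ← hus, map_sum]
    simp only [S, HopfAlgebra.antipode_mul_antidistrib]; rfl
  have hsd : ∀ i j, ∑ l, s l j * d i l = (1 : Matrix ι ι H) i j := fun i j => by
    rw [← hS, ← hsu, map_sum]
    simp only [S, HopfAlgebra.antipode_mul_antidistrib]; rfl
  have hd : ∀ i j, comul (R := k) (d i j) = ∑ l, d i l ⊗ₜ[k] d l j :=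
    hu.antipode_transpose.antipode_transpose.comul_apply
  let I : ι → H →ₗ[k] k := fun j => ∑ i, r i ∘ₗ LinearMap.mulRight k (d i j)
  have hI : ∀ j h, I j h = ∑ i, r i (h * d i j) := fun j h => by simp [I]
  have hne : ∃ j, I j ≠ 0 := by
    by_contra! hcon
    refine hr0 (funext fun p => LinearMap.ext fun h => ?_)
    calc r p h = ∑ i, r i (h * (1 : Matrix ι ι H) i p) := by
          rw [Finset.sum_eq_single p] <;> simp +contextual
      _ = ∑ j, I j (h * s j p) := by
          simp only [← hsd, Finset.mul_sum, map_sum, hI, mul_assoc]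
          exact Finset.sum_comm
      _ = 0 := by simp [hcon]
  obtain ⟨j, hj⟩ := hne
  refine ⟨I j, hj, fun h => ?_⟩
  rw [← rightAct_apply]
  let R := ℛ k h
  have hT : ∀ p l, rightAct (r p) (h * d l j) =
      ∑ t ∈ R.index, ∑ m, r p (R.right t * d m j) • (R.left t * d l m) := fun p l => by
    rw [← Finset.sum_product']
    apply rightAct_of_comul
    rw [Bialgebra.comul_mul, hd, ← R.eq, Finset.sum_mul_sum, ← Finset.sum_product']
    simp
  calc rightAct (I j) h = ∑ t ∈ R.index, I j (R.right t) • R.left t :=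
        rightAct_of_comul R.eq.symm _
    _ = ∑ p, ∑ l, rightAct (r p) (h * d l j) * s p l := by
        simp only [hT, hI, Finset.sum_mul, Finset.sum_smul]
        rw [Finset.sum_comm]
        refine Finset.sum_congr rfl fun p _ => ?_
        rw [Finset.sum_comm]
        refine Finset.sum_congr rfl fun t _ => ?_
        rw [Finset.sum_comm]
        simp only [smul_mul_assoc, mul_assoc, ← Finset.smul_sum, ← Finset.mul_sum, hds]
        simp [Matrix.one_apply]
    _ = ∑ l, ∑ i, r i (h * d l j) • ∑ p, u i p * s p l := by
        simp only [hr, Finset.sum_mul, Finset.smul_sum, smul_mul_assoc]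
        rw [Finset.sum_comm]
        refine Finset.sum_congr rfl fun l _ => Finset.sum_comm
    _ = I j h • 1 := by
        simp only [hus, hI, Finset.sum_smul]
        simp [Matrix.one_apply]

theorem isCoFrobenius_of_coradFilt_eq_top {n : ℕ} (hn : coradFilt k H n = ⊤) :
    IsCoFrobenius k H := by
  obtain ⟨f, hf, hfd⟩ := exists_finiteDimensional_range_rightAct hn
  obtain ⟨u, hu, huw⟩ := exists_isCorep_of_leftAct_mem (range (rightAct f)) (by
    rintro a _ ⟨h, rfl⟩
    exact ⟨leftAct a h, (leftAct_rightAct a f h).symm⟩)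
  let w := Module.finBasis k (range (rightAct f))
  choose ω hω using fun j => LinearMap.exists_extend (w.coord j)
  have hω' : ∀ j (x : range (rightAct f)), ω j x = w.coord j x := fun j x =>
    LinearMap.congr_fun (hω j) x
  have hw : ∀ h, rightAct f h = ∑ i, ω i (rightAct f h) • (w i : H) := fun h => by
    have := congrArg (range (rightAct f)).subtype (w.sum_repr ⟨rightAct f h, h, rfl⟩)
    simp only [map_sum, map_smul, Submodule.subtype_apply] at this
    simpa only [hω' _ ⟨rightAct f h, h, rfl⟩, Module.Basis.coord_apply] using this.symm
  refine isCoFrobenius_of_corep hu (r := fun j => ω j ∘ₗ rightAct f) (fun j h => ?_) fun h0 => ?_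
  · rw [← rightAct_rightAct, hw h, map_sum]
    refine Finset.sum_congr rfl fun i _ => ?_
    rw [map_smul, rightAct_of_comul (huw i)]
    simp [w, hω', Finsupp.single_apply]
  · refine hf (LinearMap.ext fun h => ?_)
    rw [hw h]
    exact Finset.sum_eq_zero fun i _ => by
      rw [show ω i (rightAct f h) = 0 from LinearMap.congr_fun (congrFun h0 i) h, zero_smul]

end FiniteFiltration

section Coefficients

variable {k H}

open Coalgebra LinearMap Matrix

variable {ι : Type*} [Fintype ι]

theorem mem_of_forall_dotProduct_eq_zero {X : Submodule k (ι → k)} {y : ι → k}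
    (h : ∀ ξ : ι → k, (∀ x ∈ X, ξ ⬝ᵥ x = 0) → ξ ⬝ᵥ y = 0) : y ∈ X := by
  classical
  by_contra hy
  obtain ⟨f, hf, hle⟩ := Submodule.exists_le_ker_of_notMem hy
  have hdot : ∀ x, (fun i => f (Pi.single i 1)) ⬝ᵥ x = f x := fun x => by
    conv_rhs => rw [pi_eq_sum_univ' x, map_sum]
    refine Finset.sum_congr rfl fun i _ => ?_
    rw [map_smul, smul_eq_mul, mul_comm]
  exact hf ((hdot y).symm.trans (h _ fun x hx => (hdot x).trans (hle hx)))

/-- The coefficient `ξ(c x)` of the comodule with matrix `c`. -/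
def matCoeff (c : Matrix ι ι H) (ξ x : ι → k) : H := ∑ i, ∑ j, (ξ i * x j) • c i j

theorem apply_matCoeff (c : Matrix ι ι H) (ξ x : ι → k) (a : H →ₗ[k] k) :
    a (matCoeff c ξ x) = ξ ⬝ᵥ (c.map a *ᵥ x) := by
  simp [matCoeff, dotProduct, mulVec, Finset.mul_sum, mul_assoc, mul_comm (x _)]

theorem eq_of_forall_functional {x y : H} (h : ∀ a : H →ₗ[k] k, a x = a y) : x = y := by
  rw [← sub_eq_zero, ← Module.forall_dual_apply_eq_zero_iff k]
  intro a
  rw [map_sub, h, sub_self]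

theorem mem_of_forall_functional {C : Submodule k H} {y : H}
    (h : ∀ a : H →ₗ[k] k, (∀ x ∈ C, a x = 0) → a y = 0) : y ∈ C := by
  by_contra hy
  obtain ⟨f, hf, hle⟩ := Submodule.exists_le_ker_of_notMem hy
  exact hf (h f fun x hx => hle hx)

theorem matCoeff_add (c : Matrix ι ι H) (ξ x y : ι → k) :
    matCoeff c ξ (x + y) = matCoeff c ξ x + matCoeff c ξ y :=
  eq_of_forall_functional fun a : H →ₗ[k] k => by simp [apply_matCoeff, mulVec_add, dotProduct_add]

theorem matCoeff_smul (c : Matrix ι ι H) (ξ x : ι → k) (t : k) :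
    matCoeff c ξ (t • x) = t • matCoeff c ξ x :=
  eq_of_forall_functional fun a : H →ₗ[k] k => by
    simp [apply_matCoeff, mulVec_smul, dotProduct_smul]

/-- A subspace of `ι → k` is stable if it is a subcomodule for the comodule with matrix `c`. -/
def IsStable (c : Matrix ι ι H) (X : Submodule k (ι → k)) : Prop :=
  ∀ a : H →ₗ[k] k, ∀ x ∈ X, c.map a *ᵥ x ∈ X

theorem isStable_bot (c : Matrix ι ι H) : IsStable c (⊥ : Submodule k (ι → k)) := by
  intro a x hx
  simp [(Submodule.mem_bot k).1 hx]

theorem isStable_top (c : Matrix ι ι H) : IsStable c (⊤ : Submodule k (ι → k)) :=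
  fun _ _ _ => Submodule.mem_top

theorem IsStable.matCoeff_eq_zero {c : Matrix ι ι H} {X : Submodule k (ι → k)}
    (hX : IsStable c X) {ξ x : ι → k} (hξ : ∀ y ∈ X, ξ ⬝ᵥ y = 0) (hx : x ∈ X) :
    matCoeff c ξ x = 0 :=
  eq_of_forall_functional fun a : H →ₗ[k] k => by rw [apply_matCoeff, hξ _ (hX a x hx), map_zero]

/-- The subspace of those `x ∈ X` whose coefficient `ξ(c x)` lies in `K`. -/
def coeffPreimage (c : Matrix ι ι H) (X : Submodule k (ι → k)) (ξ : ι → k) (K : Submodule k H) :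
    Submodule k (ι → k) where
  carrier := {x | x ∈ X ∧ matCoeff c ξ x ∈ K}
  zero_mem' := ⟨X.zero_mem, by simp [matCoeff]⟩
  add_mem' hx hy := ⟨X.add_mem hx.1 hy.1, by rw [matCoeff_add]; exact K.add_mem hx.2 hy.2⟩
  smul_mem' t x hx := ⟨X.smul_mem t hx.1, by rw [matCoeff_smul]; exact K.smul_mem t hx.2⟩

theorem apply_leftAct_eq (a b : H →ₗ[k] k) (h : H) : b (leftAct a h) = a (rightAct b h) := by
  rw [← counit_rightAct b, ← leftAct_rightAct, counit_leftAct]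

variable [DecidableEq ι]

theorem IsCorep.rightAct_matCoeff {c : Matrix ι ι H} (hc : IsCorep k c) (ξ x : ι → k)
    (a : H →ₗ[k] k) : rightAct a (matCoeff c ξ x) = matCoeff c ξ (c.map a *ᵥ x) :=
  eq_of_forall_functional fun b : H →ₗ[k] k => by
    rw [← LinearMap.comp_apply, apply_matCoeff, apply_matCoeff, hc.map_comp_rightAct, mulVec_mulVec]

theorem IsCorep.leftAct_matCoeff {c : Matrix ι ι H} (hc : IsCorep k c) (ξ x : ι → k)
    (a : H →ₗ[k] k) : leftAct a (matCoeff c ξ x) = matCoeff c (ξ ᵥ* c.map a) x :=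
  eq_of_forall_functional fun b : H →ₗ[k] k => by
    rw [apply_leftAct_eq, ← LinearMap.comp_apply, apply_matCoeff, apply_matCoeff,
      hc.map_comp_rightAct, ← mulVec_mulVec, dotProduct_mulVec]

theorem IsCorep.counit_matCoeff {c : Matrix ι ι H} (hc : IsCorep k c) (ξ x : ι → k) :
    counit (R := k) (matCoeff c ξ x) = ξ ⬝ᵥ x := by
  rw [apply_matCoeff, hc.map_counit, one_mulVec]

/-- A simple subquotient of a comodule is annihilated by functionals vanishing on the coradical. -/
theorem IsCorep.mulVec_mem_of_simple {c : Matrix ι ι H} (hc : IsCorep k c)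
    {X X' : Submodule k (ι → k)} (hX : IsStable c X) (hX' : IsStable c X') (hlt : X' < X)
    (hsimple : ∀ Y, IsStable c Y → X' ≤ Y → Y ≤ X → Y = X' ∨ Y = X) {a : H →ₗ[k] k}
    (ha : ∀ h ∈ coradical k H, a h = 0) {x : ι → k} (hx : x ∈ X) : c.map a *ᵥ x ∈ X' := by
  let C : Submodule k H := Submodule.span k
    {h | ∃ ξ x : ι → k, (∀ y ∈ X', ξ ⬝ᵥ y = 0) ∧ x ∈ X ∧ matCoeff c ξ x = h}
  have hC : ∀ ξ x : ι → k, (∀ y ∈ X', ξ ⬝ᵥ y = 0) → x ∈ X → matCoeff c ξ x ∈ C :=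
    fun ξ x hξ hx => Submodule.subset_span ⟨ξ, x, hξ, hx, rfl⟩
  have hCsub : IsSubcoalgebra k H C := by
    rw [isSubcoalgebra_iff]
    intro a h hh
    suffices hle : C ≤ C.comap (rightAct a) ⊓ C.comap (leftAct a) from hle hh
    refine Submodule.span_le.2 ?_
    rintro _ ⟨ξ, x, hξ, hx, rfl⟩
    refine ⟨?_, ?_⟩
    · change rightAct a _ ∈ C
      rw [hc.rightAct_matCoeff]
      exact hC _ _ hξ (hX a x hx)
    · change leftAct a _ ∈ C
      rw [hc.leftAct_matCoeff]
      exact hC _ _ (fun y hy => by rw [← dotProduct_mulVec]; exact hξ _ (hX' a y hy)) hx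
  have hstab : ∀ (ξ : ι → k) (K : Submodule k H), (∀ y ∈ X', ξ ⬝ᵥ y = 0) →
      (∀ (b : H →ₗ[k] k), ∀ h ∈ K, rightAct b h ∈ K) →
      coeffPreimage c X ξ K = X' ∨ coeffPreimage c X ξ K = X := by
    intro ξ K hξ hK
    refine hsimple _ (fun b x hx => ⟨hX b x hx.1, ?_⟩)
      (fun x hx => ⟨hlt.le hx, by rw [hX'.matCoeff_eq_zero hξ hx]; exact K.zero_mem⟩)
      fun x hx => hx.1
    rw [← hc.rightAct_matCoeff]
    exact hK b _ hx.2
  have hCsimple : IsSimpleSubcoalgebra k H C := by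
    refine ⟨?_, hCsub, fun D hDC hD => or_iff_not_imp_left.2 fun hD0 => le_antisymm hDC ?_⟩
    · obtain ⟨x, hx, hx'⟩ := SetLike.exists_of_lt hlt
      intro h0
      refine hx' (mem_of_forall_dotProduct_eq_zero fun ξ hξ => ?_)
      have := hC ξ x hξ hx
      rw [h0, Submodule.mem_bot] at this
      rw [← hc.counit_matCoeff, this, map_zero]
    obtain ⟨K, -, hK⟩ := zorn_le_nonempty₀ {K : Submodule k H |
        (∀ b : H →ₗ[k] k, ∀ h ∈ K, rightAct b h ∈ K) ∧ ∀ h ∈ K, h ∈ D → h = 0}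
      (fun s hs hchain z hz => by
        have hmem := fun h => Submodule.mem_sSup_of_directed (z := h) ⟨z, hz⟩ hchain.directedOn
        refine ⟨sSup s, ⟨fun b h hh => ?_, fun h hh => ?_⟩, fun C hC => le_sSup hC⟩
        · obtain ⟨L, hL, hhL⟩ := (hmem h).1 hh
          exact le_sSup hL ((hs hL).1 b h hhL)
        · obtain ⟨L, hL, hhL⟩ := (hmem h).1 hh
          exact (hs hL).2 h hhL) ⊥
      ⟨fun b h hh => by simp [(Submodule.mem_bot k).1 hh], fun h hh _ => by simpa using hh⟩
    have hKD : ∀ b : H →ₗ[k] k, ∀ h ∈ K ⊔ D, rightAct b h ∈ K ⊔ D := by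
      intro b h hh
      obtain ⟨p, hp, q, hq, rfl⟩ := Submodule.mem_sup.1 hh
      rw [map_add]
      exact Submodule.add_mem_sup (hK.1.1 b p hp) (hD.rightAct_mem b hq)
    have hsup : ∀ ξ x : ι → k, (∀ y ∈ X', ξ ⬝ᵥ y = 0) → x ∈ X → matCoeff c ξ x ∈ K ⊔ D := by
      intro ξ x hξ hx
      rcases hstab ξ _ hξ hKD with h | h
      · let L : Submodule k H := X.map
          { toFun := matCoeff c ξ, map_add' := matCoeff_add c ξ,
            map_smul' := fun t x => matCoeff_smul c ξ x t : (ι → k) →ₗ[k] H }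
        have hmem : ∀ y ∈ X, matCoeff c ξ y ∈ L := fun y hy => ⟨y, hy, rfl⟩
        refine Submodule.mem_sup_left (hK.2 (y := K ⊔ L) ⟨?_, ?_⟩ le_sup_left
          (Submodule.mem_sup_right (hmem x hx)))
        · intro b h hh
          obtain ⟨p, hp, _, ⟨y, hy, rfl⟩, rfl⟩ := Submodule.mem_sup.1 hh
          rw [map_add]
          refine Submodule.add_mem_sup (hK.1.1 b p hp) ?_
          change rightAct b (matCoeff c ξ y) ∈ L
          rw [hc.rightAct_matCoeff]
          exact hmem _ (hX b y hy)
        · intro h hh hhD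
          obtain ⟨p, hp, _, ⟨y, hy, rfl⟩, rfl⟩ := Submodule.mem_sup.1 hh
          change p + matCoeff c ξ y ∈ D at hhD
          change p + matCoeff c ξ y = 0
          have hy' : y ∈ X' := by
            rw [← h]
            refine ⟨hy, ?_⟩
            have := Submodule.sub_mem _ (Submodule.mem_sup_right (S := K) hhD)
              (Submodule.mem_sup_left (T := D) hp)
            rwa [add_sub_cancel_left] at this
          rw [hX'.matCoeff_eq_zero hξ hy', add_zero] at hhD ⊢
          exact hK.1.2 p hp hhD
      · have : x ∈ coeffPreimage c X ξ (K ⊔ D) := h.symm ▸ hx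
        exact this.2
    obtain ⟨ξ, hξ, x₀, hx₀, hnot⟩ : ∃ ξ : ι → k, (∀ y ∈ X', ξ ⬝ᵥ y = 0) ∧
        ∃ x ∈ X, matCoeff c ξ x ∉ K := by
      by_contra! hcon
      have hCK : C ≤ K := Submodule.span_le.2 (by
        rintro _ ⟨ξ, x, hξ, hx, rfl⟩
        exact hcon ξ hξ x hx)
      exact hD0 ((Submodule.eq_bot_iff _).2 fun h hh => hK.1.2 h (hCK (hDC hh)) hh)
    have hXK : coeffPreimage c X ξ K = X' := (hstab ξ K hξ hK.1.1).resolve_right fun h => by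
      have : x₀ ∈ coeffPreimage c X ξ K := h.symm ▸ hx₀
      exact hnot this.2
    refine Submodule.span_le.2 ?_
    rintro _ ⟨η, x, hη, hx, rfl⟩
    refine mem_of_forall_functional fun a ha => ?_
    rw [apply_matCoeff]
    refine hη _ ?_
    rw [← hXK]
    refine ⟨hX a x hx, ?_⟩
    rw [← hc.rightAct_matCoeff]
    obtain ⟨p, hp, q, hq, hpq⟩ := Submodule.mem_sup.1 (hsup ξ x hξ hx)
    rw [← hpq, map_add, hD.rightAct_eq_zero ha hq, add_zero]
    exact hK.1.1 a p hp
  refine mem_of_forall_dotProduct_eq_zero fun ξ hξ => ?_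
  rw [← apply_matCoeff]
  exact ha _ (le_sSup (a := C) hCsimple (hC ξ x hξ hx))

/-- Functionals vanishing on the `n`-th term of the coradical filtration map `X` into `X'`. -/
def CoradMapsTo (c : Matrix ι ι H) (n : ℕ) (X X' : Submodule k (ι → k)) : Prop :=
  ∀ b : H →ₗ[k] k, (∀ h ∈ coradFilt k H n, b h = 0) → ∀ x ∈ X, c.map b *ᵥ x ∈ X'

theorem IsCorep.coradMapsTo_succ {c : Matrix ι ι H} (hc : IsCorep k c) {n : ℕ}
    {X X'' X' : Submodule k (ι → k)} (h₁ : CoradMapsTo c n X X'')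
    (h₂ : CoradMapsTo c 0 X'' X') : CoradMapsTo c (n + 1) X X' := by
  intro b hb x hx
  refine mem_of_forall_dotProduct_eq_zero fun ξ hξ => ?_
  rw [← apply_matCoeff]
  refine hb _ (mem_coradFilt_succ fun a b ha hb => ?_)
  rw [hc.rightAct_matCoeff, apply_matCoeff]
  exact hξ _ (h₂ a ha _ (h₁ b hb x hx))

theorem coradFilt_eq_top_of_coradMapsTo {n : ℕ}
    (h : ∀ (m : ℕ) (c : Matrix (Fin m) (Fin m) H), IsCorep k c →
      CoradMapsTo c n (⊤ : Submodule k (Fin m → k)) ⊥) : coradFilt k H n = ⊤ := by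
  refine eq_top_iff.2 fun x _ => mem_of_forall_functional fun b hb => ?_
  obtain ⟨m, c, hc, hx⟩ := exists_isCorep_mem_span (k := k) x
  suffices hle : Submodule.span k (Set.range fun p : Fin m × Fin m => c p.1 p.2) ≤ ker b from
    hle hx
  refine Submodule.span_le.2 ?_
  rintro _ ⟨⟨i, j⟩, rfl⟩
  have := congrFun ((Submodule.mem_bot k).1 (h m c hc b hb (Pi.single j 1) trivial)) i
  simpa using this

end Coefficients

section Averaging

variable {k H}

open Coalgebra LinearMap Matrix

variable {ι κ ζ : Type*} [Fintype ι] [Fintype κ] [Fintype ζ]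

/-- The linear map between comodules obtained from the matrix `s` by averaging against `r`. -/
def average (z : Matrix ζ ζ H) (c : Matrix ι ι H) (r : H →ₗ[k] k) (s : Matrix ζ ι k) :
    Matrix ζ ι k :=
  (conjMatrix z c s).map r

theorem average_add (z : Matrix ζ ζ H) (c : Matrix ι ι H) (r : H →ₗ[k] k) (s t : Matrix ζ ι k) :
    average z c r (s + t) = average z c r s + average z c r t := by
  ext i j
  have : (s + t).map (algebraMap k H) = s.map (algebraMap k H) + t.map (algebraMap k H) :=
    Matrix.map_add _ (map_add _) s t
  simp [average, conjMatrix, this, Matrix.mul_add, Matrix.add_mul]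

theorem mul_average {z : Matrix ζ ζ H} {c : Matrix ι ι H} {p : Matrix ι ζ k}
    (hp : c * p.map (algebraMap k H) = p.map (algebraMap k H) * z) (r : H →ₗ[k] k)
    (s : Matrix ζ ι k) : p * average z c r s = average c c r (p * s) := by
  have h : conjMatrix c c (p * s) = p.map (algebraMap k H) * conjMatrix z c s := by
    rw [conjMatrix, conjMatrix, Matrix.map_mul, ← Matrix.mul_assoc c, hp]
    simp only [Matrix.mul_assoc]
  rw [average, average, h]
  ext i j
  simp [Matrix.mul_apply, ← Algebra.smul_def]

variable [DecidableEq ι]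

theorem IsCorep.average_one {c : Matrix ι ι H} (hc : IsCorep k c) {r : H →ₗ[k] k} (hr : r 1 = 1) :
    average c c r 1 = 1 := by
  rw [average, conjMatrix, Matrix.map_one _ (map_zero _) (map_one _), Matrix.mul_one,
    hc.mul_antipode, Matrix.map_one _ (map_zero _) hr]

theorem exists_projection (X : Submodule k (ι → k)) :
    ∃ P : Matrix ι ι k, (∀ x ∈ X, P *ᵥ x = x) ∧ ∀ x, P *ᵥ x ∈ X := by
  obtain ⟨p, hp⟩ := X.subtype.exists_leftInverse_of_injective (Submodule.ker_subtype X)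
  refine ⟨LinearMap.toMatrix' (X.subtype ∘ₗ p), fun x hx => ?_, fun x => ?_⟩
  · rw [LinearMap.toMatrix'_mulVec]
    exact congrArg X.subtype (LinearMap.congr_fun hp ⟨x, hx⟩)
  · rw [LinearMap.toMatrix'_mulVec]
    exact (p x).2

theorem average_mulVec_mem {z : Matrix ζ ζ H} {c : Matrix ι ι H} {X : Submodule k (ι → k)}
    {Z : Submodule k (ζ → k)} (hX : IsStable c X) (hZ : IsStable z Z) {s : Matrix ζ ι k}
    (hs : ∀ x ∈ X, s *ᵥ x ∈ Z) (r : H →ₗ[k] k) {x : ι → k} (hx : x ∈ X) :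
    average z c r s *ᵥ x ∈ Z := by
  obtain ⟨P, hP, hPX⟩ := exists_projection X
  refine mem_of_forall_dotProduct_eq_zero fun ξ hξ => ?_
  let A := algebraMap k H
  set v : ι → H := c.map (HopfAlgebra.antipode k) *ᵥ (A ∘ x) with hv
  have hS : ∀ η, HopfAlgebra.antipode k (matCoeff c η x) = ∑ i, η i • v i := fun η => by
    simp only [matCoeff, map_sum, map_smul, hv, mulVec, dotProduct, Finset.smul_sum]
    refine Finset.sum_congr rfl fun i _ => Finset.sum_congr rfl fun j _ => ?_
    rw [mul_smul, Function.comp_apply, ← Algebra.commutes, ← Algebra.smul_def, Matrix.map_apply]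
  have hPv : P.map A *ᵥ v = v := by
    ext i
    have h0 : matCoeff c (P i - Pi.single i 1) x = 0 := by
      refine hX.matCoeff_eq_zero (fun y hy => ?_) hx
      rw [sub_dotProduct, single_one_dotProduct, sub_eq_zero]
      exact congrFun (hP y hy) i
    have h1 := hS (P i - Pi.single i 1)
    simp only [h0, map_zero, Pi.sub_apply, sub_smul, Finset.sum_sub_distrib] at h1
    rw [eq_comm, sub_eq_zero] at h1
    simpa [mulVec, dotProduct, A, ← Algebra.smul_def, Pi.single_apply] using h1
  have hz : (A ∘ ξ) ᵥ* (z * (s * P).map A) = 0 := by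
    ext l
    have h0 := hZ.matCoeff_eq_zero (x := (s * P) *ᵥ Pi.single l 1) hξ (by
      rw [← mulVec_mulVec]
      exact hs _ (hPX _))
    rw [Pi.zero_apply, ← h0, mulVec_single_one]
    simp only [matCoeff, vecMul, dotProduct, Matrix.mul_apply', Finset.mul_sum]
    refine Finset.sum_congr rfl fun e _ => Finset.sum_congr rfl fun b _ => ?_
    rw [mul_smul, Algebra.smul_def, Algebra.smul_def, Algebra.commutes ((s * P).col l b)]
    rfl
  have key : (A ∘ ξ) ⬝ᵥ (conjMatrix z c s *ᵥ (A ∘ x)) = 0 := by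
    rw [conjMatrix, ← mulVec_mulVec, ← hv, ← hPv, mulVec_mulVec, Matrix.mul_assoc,
      ← Matrix.map_mul, dotProduct_mulVec, hz, zero_dotProduct]
  have := congrArg r key
  rw [map_zero] at this
  rw [← this]
  simp [average, dotProduct, mulVec, A, ← Algebra.smul_def, ← Algebra.commutes, mul_comm]

/-- A family of functionals transforming under the right action through the matrix `u`. -/
structure IsEquivariant (u : Matrix κ κ H) (r : κ → H →ₗ[k] k) : Prop where
  rightAct_apply : ∀ j h, rightAct (r j) h = ∑ i, r i h • u i j

theorem IsEquivariant.mul_average_apply {u : Matrix κ κ H} {r : κ → H →ₗ[k] k}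
    [DecidableEq ζ] (hr : IsEquivariant u r) {z : Matrix ζ ζ H} {c : Matrix ι ι H}
    (hz : IsCorep k z) (hc : IsCorep k c) (s : Matrix ζ ι k) (j : κ) (a : ζ) (d : ι) :
    ∑ b, average z c (r j) s b d • z a b =
      ∑ i, ∑ b, average z c (r i) s a b • (u i j * c b d) := by
  have h := congrFun (congrFun (conjMatrix_rightAct hz hc s (r j)) a) d
  simp only [Matrix.mul_apply, Matrix.map_apply, hr.rightAct_apply, Finset.sum_mul,
    smul_mul_assoc] at h
  simp only [average, Matrix.map_apply]
  rw [Finset.sum_comm, h]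
  simp [Algebra.smul_def, Algebra.commutes]

theorem finrank_iSup_le {V : Type*} [AddCommGroup V] [Module k V] [FiniteDimensional k V]
    (W : κ → Submodule k V) :
    Module.finrank k (⨆ j, W j : Submodule k V) ≤ ∑ j, Module.finrank k (W j) := by
  classical
  rw [← Finset.sup_univ_eq_iSup]
  induction (Finset.univ : Finset κ) using Finset.induction_on with
  | empty => simp
  | insert i s hi ih =>
    rw [Finset.sup_insert, Finset.sum_insert hi]
    exact (Submodule.finrank_add_le_finrank_add_finrank _ _).trans (by gcongr)

theorem finrank_map_add_le {V V' : Type*} [AddCommGroup V] [Module k V] [FiniteDimensional k V]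
    [AddCommGroup V'] [Module k V'] (f : V →ₗ[k] V') {X X' : Submodule k V} (hle : X' ≤ X)
    (hf : ∀ x ∈ X', f x = 0) :
    Module.finrank k (X.map f) + Module.finrank k X' ≤ Module.finrank k X := by
  have h := LinearMap.finrank_range_add_finrank_ker (f.domRestrict X)
  rw [LinearMap.range_domRestrict] at h
  rw [← h, ← (Submodule.comapSubtypeEquivOfLe hle).finrank_eq]
  gcongr
  exact Submodule.finrank_mono fun x hx => hf _ hx

end Averaging

section Integral

variable {k H}

open Coalgebra LinearMap Matrix

/-- Translating a nonzero integral by coefficients gives an equivariant family of functionals. -/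
theorem IsCoFrobenius.exists_isEquivariant (hH : IsCoFrobenius k H) :
    ∃ (m : ℕ) (u : Matrix (Fin m) (Fin m) H) (r : Fin m → H →ₗ[k] k) (p : Fin m),
      IsCorep k u ∧ IsEquivariant u r ∧ r p 1 = 1 := by
  obtain ⟨I, hI0, hI⟩ := hH
  obtain ⟨h, hh⟩ : ∃ h, I h ≠ 0 := by
    by_contra! hcon
    exact hI0 (LinearMap.ext hcon)
  obtain ⟨m, c, hc, hhc⟩ := exists_isCorep_mem_span (k := k) h
  obtain ⟨p, q, hpq⟩ : ∃ p q, I (c p q) ≠ 0 := by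
    by_contra! hcon
    have hle : Submodule.span k (Set.range fun p : Fin m × Fin m => c p.1 p.2) ≤ ker I :=
      Submodule.span_le.2 (by rintro _ ⟨⟨i, j⟩, rfl⟩; exact hcon i j)
    exact hh (hle hhc)
  let r : Fin m → H →ₗ[k] k := fun l => (I (c p q))⁻¹ • I ∘ₗ LinearMap.mulLeft k (c l q)
  refine ⟨m, _, r, p, hc.antipode_transpose, ⟨fun j y => ?_⟩, by simp [r, hpq]⟩
  let R := ℛ k y
  have hT : ∀ l, ∑ t ∈ R.index, ∑ i, I (c i q * R.right t) • (c l i * R.left t) =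
      I (c l q * y) • (1 : H) := fun l => by
    rw [← hI, ← rightAct_apply, ← Finset.sum_product']
    symm
    apply rightAct_of_comul
    rw [Bialgebra.comul_mul, hc.comul_apply, ← R.eq, Finset.sum_mul_sum, Finset.sum_comm,
      ← Finset.sum_product']
    simp
  have hSc : ∀ i, ∑ l, HopfAlgebra.antipode k (c j l) * c l i =
      (1 : Matrix (Fin m) (Fin m) H) j i :=
    fun i => by rw [← hc.antipode_mul, Matrix.mul_apply]; rfl
  rw [rightAct_of_comul R.eq.symm]
  symm
  calc ∑ l, r l y • ((c.map (HopfAlgebra.antipode k))ᵀ) l j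
      = ∑ l, (I (c p q))⁻¹ • (HopfAlgebra.antipode k (c j l) * (I (c l q * y) • (1 : H))) := by
        simp [r, mul_smul]
    _ = ∑ t ∈ R.index, ∑ i, ((I (c p q))⁻¹ * I (c i q * R.right t)) •
          ((∑ l, HopfAlgebra.antipode k (c j l) * c l i) * R.left t) := by
        simp only [← hT, Finset.mul_sum, Finset.smul_sum, Finset.sum_mul, mul_smul_comm, mul_smul,
          mul_assoc]
        rw [Finset.sum_comm]
        exact Finset.sum_congr rfl fun t _ => Finset.sum_comm
    _ = ∑ t ∈ R.index, r j (R.right t) • R.left t := by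
        simp [hSc, Matrix.one_apply, r]

theorem exists_section {V V' : Type*} [AddCommGroup V] [Module k V] [AddCommGroup V'] [Module k V']
    (f : V' →ₗ[k] V) {Z : Submodule k V'} {M : Submodule k V} (hle : M ≤ Z.map f) :
    ∃ g : V →ₗ[k] V', (∀ v, g v ∈ Z) ∧ ∀ v ∈ M, f (g v) = v := by
  obtain ⟨g₀, hg₀⟩ := (f ∘ₗ Z.subtype).rangeRestrict.exists_rightInverse_of_surjective
    (LinearMap.range_rangeRestrict _)
  obtain ⟨g₁, hg₁⟩ := LinearMap.exists_extend g₀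
  refine ⟨Z.subtype ∘ₗ g₁, fun v => (g₁ v).2, fun v hv => ?_⟩
  obtain ⟨w, hw, rfl⟩ := hle hv
  have hv' : f w ∈ range (f ∘ₗ Z.subtype) := ⟨⟨w, hw⟩, rfl⟩
  have h₁ : g₁ (f w) = g₀ ⟨f w, hv'⟩ := LinearMap.congr_fun hg₁ ⟨f w, hv'⟩
  have h₀ := congrArg Subtype.val (LinearMap.congr_fun hg₀ ⟨f w, hv'⟩)
  simpa [h₁] using h₀

variable {ι κ : Type*} [Fintype ι] [Fintype κ]

theorem IsStable.sup {c : Matrix ι ι H} {X Y : Submodule k (ι → k)} (hX : IsStable c X)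
    (hY : IsStable c Y) : IsStable c (X ⊔ Y) := by
  intro a x hx
  obtain ⟨y, hy, z, hz, rfl⟩ := Submodule.mem_sup.1 hx
  rw [mulVec_add]
  exact Submodule.add_mem_sup (hX a y hy) (hY a z hz)

/-- A sum of images of `X` is stable as soon as the maps are permuted by the coefficients. -/
theorem isStable_iSup_map {η : Type*} {c : Matrix ι ι H} {X : Submodule k (ι → k)}
    (hX : IsStable c X) (Θ : η → Matrix ι ι k) (hΘ : ∀ (a : H →ₗ[k] k) (e : η),
      ∃ (s : Finset η) (b : η → H →ₗ[k] k), c.map a * Θ e = ∑ f ∈ s, Θ f * c.map (b f)) :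
    IsStable c (⨆ e, X.map (Θ e).mulVecLin) := by
  intro a x hx
  suffices hle : (⨆ e, X.map (Θ e).mulVecLin) ≤
      (⨆ e, X.map (Θ e).mulVecLin).comap (c.map a).mulVecLin from hle hx
  refine iSup_le fun e => ?_
  rintro _ ⟨y, hy, rfl⟩
  obtain ⟨s, b, hb⟩ := hΘ a e
  rw [Submodule.mem_comap, mulVecLin_apply, mulVecLin_apply, mulVec_mulVec, hb, sum_mulVec]
  refine Submodule.sum_mem _ fun f _ => Submodule.mem_iSup_of_mem f ?_
  rw [← mulVec_mulVec]
  exact ⟨_, hX _ y hy, rfl⟩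

theorem finrank_le_of_gluing {Φ : κ → Matrix ι ι k} {M N : Submodule k (ι → k)} (hNM : N ≤ M)
    (hN : ∀ j, ∀ x ∈ N, Φ j *ᵥ x = 0) (hM : ⨆ j, M.map (Φ j).mulVecLin = M) :
    Module.finrank k M + Fintype.card κ * Module.finrank k N ≤
      Fintype.card κ * Module.finrank k M := by
  have h := finrank_iSup_le (fun j => M.map (Φ j).mulVecLin)
  rw [hM] at h
  calc _ ≤ ∑ j, Module.finrank k (M.map (Φ j).mulVecLin) +
        Fintype.card κ * Module.finrank k N := by gcongr
    _ = ∑ j : κ, (Module.finrank k (M.map (Φ j).mulVecLin) + Module.finrank k N) := by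
      simp [Finset.sum_add_distrib]
    _ ≤ ∑ j : κ, Module.finrank k M :=
      Finset.sum_le_sum fun j _ => finrank_map_add_le _ hNM (hN j)
    _ = _ := by simp

variable [DecidableEq ι]

theorem IsEquivariant.exists_gluing {u : Matrix κ κ H} {r : κ → H →ₗ[k] k}
    (hr : IsEquivariant u r) {p : κ} (hp : r p 1 = 1) {c : Matrix ι ι H} (hc : IsCorep k c)
    {M N : Submodule k (ι → k)} (hM : IsStable c M) (hN : IsStable c N) (hNM : N ≤ M)
    (hmin : ∀ Y, IsStable c Y → Y ≤ M → M ≤ Y ⊔ N → Y = M) :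
    ∃ Φ : κ → Matrix ι ι k,
      (∀ j a d, ∑ b, Φ j b d • c a b = ∑ i, ∑ b, Φ i a b • (u i j * c b d)) ∧
      (∀ j, ∀ x ∈ N, Φ j *ᵥ x = 0) ∧ ⨆ j, M.map (Φ j).mulVecLin = M := by
  obtain ⟨P, hP, hPN⟩ := exists_projection N
  refine ⟨fun j => average c c (r j) (1 - P), fun j a d => hr.mul_average_apply hc hc _ _ _ _,
    fun j x hx => (Submodule.mem_bot k).1 (average_mulVec_mem hN (isStable_bot c)
      (fun y hy => by simp [sub_mulVec, hP y hy]) (r j) hx), hmin _ ?_ ?_ ?_⟩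
  · refine isStable_iSup_map hM _ fun a j =>
      ⟨Finset.univ, fun i => a ∘ₗ LinearMap.mulLeft k (u i j), ?_⟩
    ext b d
    have := congrArg a (hr.mul_average_apply hc hc (1 - P) j b d)
    simp only [map_sum, map_smul, smul_eq_mul] at this
    simp only [Matrix.mul_apply, Matrix.sum_apply, Matrix.map_apply, LinearMap.comp_apply,
      LinearMap.mulLeft_apply, ← this, mul_comm]
  · refine iSup_le fun j => ?_
    rintro _ ⟨x, hx, rfl⟩
    exact average_mulVec_mem hM hM (fun y hy => by
      rw [sub_mulVec, one_mulVec]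
      exact M.sub_mem hy (hNM (hPN y))) (r j) hx
  · intro x hx
    have h1 : average c c (r p) (1 - P) *ᵥ x + average c c (r p) P *ᵥ x = x := by
      rw [← add_mulVec, ← average_add, sub_add_cancel, hc.average_one hp, one_mulVec]
    rw [← h1]
    exact Submodule.add_mem_sup (Submodule.mem_iSup_of_mem p ⟨x, hx, rfl⟩)
      (average_mulVec_mem hM hN (fun y _ => hPN y) (r p) hx)

theorem IsEquivariant.finrank_le [DecidableEq κ] {u : Matrix κ κ H} (hu : IsCorep k u)
    {r : κ → H →ₗ[k] k} (hr : IsEquivariant u r) {q : κ} (hq : r q 1 = 1) {c : Matrix ι ι H}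
    (hc : IsCorep k c) {M N : Submodule k (ι → k)} (hM : IsStable c M) (hN : IsStable c N)
    (hNM : N ≤ M) (hmax : ∀ Y, IsStable c Y → N ≤ Y → Y ≤ M → Y = N ∨ Y = M)
    {Φ : κ → Matrix ι ι k}
    (hΦ : ∀ j a d, ∑ b, Φ j b d • c a b = ∑ i, ∑ b, Φ i a b • (u i j * c b d))
    (hΦN : ∀ j, ∀ x ∈ N, Φ j *ᵥ x = 0) (hΦM : ⨆ j, M.map (Φ j).mulVecLin = M)
    {X X' : Submodule k (ι → k)} (hX : IsStable c X) (hX' : IsStable c X') (hlt : X' < X)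
    (hXM : X ≤ M) :
    Module.finrank k M + Fintype.card κ ^ 2 * Module.finrank k X' ≤
      Module.finrank k N + Fintype.card κ ^ 2 * Module.finrank k X := by
  let z : Matrix (κ × ι) (κ × ι) H := Matrix.kroneckerMap (· * ·) u c
  have hz : IsCorep k z := hu.kronecker hc
  let p : Matrix ι (κ × ι) k := Matrix.of fun a e => Φ e.1 a e.2
  have hp : c * p.map (algebraMap k H) = p.map (algebraMap k H) * z := by
    ext a ⟨j, d⟩
    have := hΦ j a d
    simp only [Algebra.smul_def] at this
    simp only [Matrix.mul_apply, Matrix.map_apply, ← Algebra.commutes, p, z, Matrix.of_apply,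
      kroneckerMap_apply, Fintype.sum_prod_type, this]
  have hpv : ∀ w : κ × ι → k, p *ᵥ w = ∑ j, Φ j *ᵥ fun b => w (j, b) := fun w => by
    ext a
    simp [mulVec, dotProduct, p, Fintype.sum_prod_type]
  let Z : Submodule k (κ × ι → k) := ⨅ j, M.comap (LinearMap.funLeft k k (Prod.mk j))
  have hZmem : ∀ w : κ × ι → k, w ∈ Z ↔ ∀ j, (fun b => w (j, b)) ∈ M := fun w => by
    simp only [Z, Submodule.mem_iInf, Submodule.mem_comap]; rfl
  have hZ : IsStable z Z := by
    intro a w hw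
    rw [hZmem] at hw ⊢
    intro j
    have : (fun b => (z.map a *ᵥ w) (j, b)) =
        ∑ i, c.map (a ∘ₗ LinearMap.mulLeft k (u j i)) *ᵥ fun b => w (i, b) := by
      ext b
      simp [mulVec, dotProduct, z, Fintype.sum_prod_type]
    rw [this]
    exact M.sum_mem fun i _ => hM _ _ (hw i)
  have hMZ : M ≤ Z.map p.mulVecLin := by
    conv_lhs => rw [← hΦM]
    refine iSup_le fun j => ?_
    rintro _ ⟨x, hx, rfl⟩
    refine ⟨fun e => if e.1 = j then x e.2 else 0, (hZmem _).2 fun i => ?_, ?_⟩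
    · by_cases hij : i = j
      · simpa [hij] using hx
      · simp only [hij, if_false]
        exact M.zero_mem
    · rw [mulVecLin_apply, hpv, mulVecLin_apply, Finset.sum_eq_single j]
      · simp
      · intro i _ hij
        simp only [hij, if_false]
        exact mulVec_zero _
      · simp
  obtain ⟨g, hgZ, hgM⟩ := exists_section p.mulVecLin hMZ
  obtain ⟨P, hP, hPX⟩ := exists_projection X'
  let τ : Matrix (κ × ι) ι k := LinearMap.toMatrix' g * (1 - P)
  have hτ : ∀ x, τ *ᵥ x = g (x - P *ᵥ x) := fun x => by
    rw [← mulVec_mulVec, LinearMap.toMatrix'_mulVec, sub_mulVec, one_mulVec]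
  let Θ : κ × κ → Matrix ι ι k := fun e => Matrix.of fun b d => average z c (r e.1) τ (e.2, b) d
  have hΘv : ∀ e x b, (Θ e *ᵥ x) b = (average z c (r e.1) τ *ᵥ x) (e.2, b) := fun e x b => rfl
  have hΘX' : ∀ e, ∀ x ∈ X', Θ e *ᵥ x = 0 := fun e x hx => by
    have := (Submodule.mem_bot k).1 (average_mulVec_mem (s := τ) hX' (isStable_bot z)
      (fun y hy => by simp [hτ, hP y hy]) (r e.1) hx)
    ext b
    rw [hΘv, this]; rfl
  have hΘM : ∀ e, ∀ x ∈ X, Θ e *ᵥ x ∈ M := fun e x hx =>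
    (hZmem _).1 (average_mulVec_mem (s := τ) hX hZ (fun y _ => by rw [hτ]; exact hgZ _) (r e.1) hx)
      e.2
  have hpΘ : ∀ x ∈ X, x - ∑ l, Φ l *ᵥ (Θ (q, l) *ᵥ x) ∈ X' := fun x hx => by
    have h1 : ∑ l, Φ l *ᵥ (Θ (q, l) *ᵥ x) = average c c (r q) (p * τ) *ᵥ x := by
      rw [← mul_average hp, ← mulVec_mulVec, hpv]; rfl
    have h2 : average c c (r q) (p * τ) *ᵥ x + average c c (r q) (1 - p * τ) *ᵥ x = x := by
      rw [← add_mulVec, ← average_add, add_sub_cancel, hc.average_one hq, one_mulVec]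
    rw [h1, sub_eq_iff_eq_add'.2 h2.symm]
    refine average_mulVec_mem hX hX' (fun y hy => ?_) (r q) hx
    have h3 := hgM (y - P *ᵥ y) (M.sub_mem (hXM hy) (hXM (hlt.le (hPX y))))
    rw [mulVecLin_apply] at h3
    rw [sub_mulVec, one_mulVec, ← mulVec_mulVec, hτ, h3, sub_sub_cancel]
    exact hPX y
  have hΘc : ∀ (a : H →ₗ[k] k) (j t : κ), c.map a * Θ (j, t) = ∑ e, Θ e *
      c.map (a ∘ₗ LinearMap.mulLeft k (HopfAlgebra.antipode k (u t e.2) * u e.1 j)) := by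
    intro a j t
    ext b d
    have hSu : ∀ i, ∑ l, HopfAlgebra.antipode k (u t l) * u l i = (1 : Matrix κ κ H) t i :=
      fun i => by rw [← hu.antipode_mul, Matrix.mul_apply]; rfl
    have h1 : ∑ l, HopfAlgebra.antipode k (u t l) *
        ∑ e, average z c (r j) τ e d • z (l, b) e = ∑ f, Θ (j, t) f d • c b f := by
      calc _ = ∑ e : κ × ι, average z c (r j) τ e d •
            ((∑ l, HopfAlgebra.antipode k (u t l) * u l e.1) * c b e.2) := by
            simp only [Finset.mul_sum, Finset.sum_mul, Finset.smul_sum, mul_smul_comm]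
            rw [Finset.sum_comm]
            simp [z, mul_assoc]
        _ = _ := by
            simp only [hSu, Fintype.sum_prod_type]
            rw [Finset.sum_eq_single t]
            · simp [Θ]
            · intro i _ hi
              simp [Matrix.one_apply_ne hi.symm]
            · simp
    simp only [hr.mul_average_apply hz hc] at h1
    have h2 := congrArg a h1.symm
    simp only [map_sum, map_smul, smul_eq_mul, Finset.mul_sum, mul_smul_comm] at h2
    simp only [Matrix.mul_apply, Matrix.sum_apply, Matrix.map_apply, mul_comm (a _), h2,
      Fintype.sum_prod_type, LinearMap.comp_apply, LinearMap.mulLeft_apply, mul_assoc]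
    rw [Finset.sum_comm]
    rfl
  have hW : IsStable c (⨆ e, X.map (Θ e).mulVecLin) :=
    isStable_iSup_map hX Θ fun a e => ⟨Finset.univ, _, hΘc a e.1 e.2⟩
  have hWM : N ⊔ ⨆ e, X.map (Θ e).mulVecLin = M := by
    refine (hmax _ (hN.sup hW) le_sup_left (sup_le hNM (iSup_le fun e => ?_))).resolve_left
      fun h => ?_
    · rintro _ ⟨x, hx, rfl⟩
      exact hΘM e x hx
    · refine hlt.not_ge fun x hx => ?_
      have hxN : ∀ l, Θ (q, l) *ᵥ x ∈ N := fun l => by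
        rw [← h]
        exact Submodule.mem_sup_right (Submodule.mem_iSup_of_mem (q, l) ⟨x, hx, rfl⟩)
      simpa [hΦN _ _ (hxN _)] using hpΘ x hx
  have h1 := (Submodule.finrank_add_le_finrank_add_finrank N (⨆ e, X.map (Θ e).mulVecLin)).trans
    (add_le_add_right (finrank_iSup_le fun e => X.map (Θ e).mulVecLin) _)
  rw [hWM] at h1
  have hcard : Fintype.card (κ × κ) = Fintype.card κ ^ 2 := by rw [Fintype.card_prod, sq]
  have h2 : ∑ e, Module.finrank k (X.map (Θ e).mulVecLin) +
      Fintype.card κ ^ 2 * Module.finrank k X' ≤ Fintype.card κ ^ 2 * Module.finrank k X := by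
    calc _ = ∑ e : κ × κ, (Module.finrank k (X.map (Θ e).mulVecLin) + Module.finrank k X') := by
          rw [Finset.sum_add_distrib, Finset.sum_const, Finset.card_univ, hcard, smul_eq_mul]
      _ ≤ ∑ e : κ × κ, Module.finrank k X :=
          Finset.sum_le_sum fun e _ => finrank_map_add_le _ hlt.le (hΘX' e)
      _ = _ := by rw [Finset.sum_const, Finset.card_univ, hcard, smul_eq_mul]
  omega

end Integral

section Finite

variable {k H}

open LinearMap Matrix

variable {ι : Type*} [Fintype ι]

theorem IsStable.coradMapsTo {c : Matrix ι ι H} {X : Submodule k (ι → k)} (hX : IsStable c X)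
    (n : ℕ) : CoradMapsTo c n X X := fun b _ => hX b

variable [DecidableEq ι]

/-- If every strict inclusion of stable subspaces of `M` has codimension at least `D / Q`, then
subquotients of dimension less than `(n + 2) D / Q` have Loewy length at most `n + 1`. -/
theorem IsCorep.coradMapsTo_of_finrank_lt {c : Matrix ι ι H} (hc : IsCorep k c) {D Q : ℕ}
    {M : Submodule k (ι → k)}
    (hM : ∀ X X', IsStable c X → IsStable c X' → X' < X → X ≤ M →
      D + Q * Module.finrank k X' ≤ Q * Module.finrank k X)
    (n : ℕ) {X X' : Submodule k (ι → k)} (hX : IsStable c X) (hX' : IsStable c X') (hle : X' ≤ X)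
    (hXM : X ≤ M) (hlt : Q * Module.finrank k X < (n + 2) * D + Q * Module.finrank k X') :
    CoradMapsTo c n X X' := by
  induction n generalizing X' with
  | zero =>
    obtain rfl | hlt' := hle.eq_or_lt
    · exact hX.coradMapsTo 0
    refine fun a ha x hx => hc.mulVec_mem_of_simple hX hX' hlt' (fun Y hY h₁ h₂ => ?_) ha hx
    by_contra! hne
    have h₃ := hM Y X' hY hX' (h₁.lt_of_ne hne.1.symm) (h₂.trans hXM)
    have h₄ := hM X Y hX hY (h₂.lt_of_ne hne.2) hXM
    omega
  | succ n ih =>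
    obtain rfl | hlt' := hle.eq_or_lt
    · exact hX.coradMapsTo _
    obtain ⟨Y, ⟨hY, hX'Y, hYX⟩, hmin⟩ := wellFounded_lt.has_min
      {Y : Submodule k (ι → k) | IsStable c Y ∧ X' < Y ∧ Y ≤ X} ⟨X, hX, hlt', le_rfl⟩
    refine hc.coradMapsTo_succ (X'' := Y) (ih hY hYX ?_) fun a ha x hx =>
      hc.mulVec_mem_of_simple hY hX' hX'Y (fun Z hZ h₁ h₂ => ?_) ha hx
    · have := hM Y X' hY hX' hX'Y (hYX.trans hXM)
      linarith
    · by_contra! hne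
      exact hmin Z ⟨hZ, h₁.lt_of_ne hne.1.symm, h₂.trans hYX⟩ (h₂.lt_of_ne hne.2)

theorem IsEquivariant.coradMapsTo {κ : Type*} [Fintype κ] [DecidableEq κ] {u : Matrix κ κ H}
    (hu : IsCorep k u) {r : κ → H →ₗ[k] k} (hr : IsEquivariant u r) {p : κ} (hp : r p 1 = 1)
    {c : Matrix ι ι H} (hc : IsCorep k c) :
    CoradMapsTo c (Fintype.card κ ^ 3) (⊤ : Submodule k (ι → k)) ⊥ := by
  by_contra hcon
  obtain ⟨M, ⟨hM, hM'⟩, hMmin⟩ := wellFounded_lt.has_min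
    {M : Submodule k (ι → k) | IsStable c M ∧ ¬ CoradMapsTo c (Fintype.card κ ^ 3) M ⊥}
    ⟨⊤, isStable_top c, hcon⟩
  have hmin : ∀ Y, IsStable c Y → Y < M → CoradMapsTo c (Fintype.card κ ^ 3) Y ⊥ :=
    fun Y hY hlt => by_contra fun h => hMmin Y ⟨hY, h⟩ hlt
  have hM0 : ⊥ < M := by
    refine bot_lt_iff_ne_bot.2 ?_
    rintro rfl
    exact hM' (hM.coradMapsTo _)
  obtain ⟨N, ⟨hN, hNM⟩, hNmax⟩ := wellFounded_gt.has_min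
    {N : Submodule k (ι → k) | IsStable c N ∧ N < M} ⟨⊥, isStable_bot c, hM0⟩
  obtain ⟨Φ, hΦ, hΦN, hΦM⟩ := hr.exists_gluing hp hc hM hN hNM.le fun Y hY hYM hMY => by
    by_contra hne
    refine hM' fun b hb x hx => ?_
    obtain ⟨y, hy, z, hz, rfl⟩ := Submodule.mem_sup.1 (hMY hx)
    rw [mulVec_add]
    exact Submodule.add_mem _ (hmin Y hY (hYM.lt_of_ne hne) b hb y hy) (hmin N hN hNM b hb z hz)
  have hfin := finrank_le_of_gluing hNM.le hΦN hΦM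
  have hlt := Submodule.finrank_lt_finrank_of_lt hNM
  obtain ⟨D, hD⟩ := Nat.exists_eq_add_of_lt hlt
  refine hM' (hc.coradMapsTo_of_finrank_lt (D := D + 1) (Q := Fintype.card κ ^ 2) (M := M)
    (fun X X' hX hX' hX'X hXM => ?_) _ hM (isStable_bot c) hM0.le le_rfl ?_)
  · have := hr.finrank_le hu hp hc hM hN hNM.le (fun Y hY h₁ h₂ => or_iff_not_imp_right.2 fun h =>
      by_contra fun h' => hNmax Y ⟨hY, h₂.lt_of_ne h⟩ (h₁.lt_of_ne (Ne.symm h')))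
      hΦ hΦN hΦM hX hX' hX'X hXM
    omega
  · have h₁ : Module.finrank k M ≤ Fintype.card κ * (D + 1) := by
      rw [hD] at hfin ⊢
      linarith
    have h₂ := Nat.mul_le_mul_left (Fintype.card κ ^ 2) h₁
    rw [finrank_bot]
    linarith

end Finite

/-- A Hopf algebra is co-Frobenius if and only if its coradical filtration is finite. -/
theorem coFrobenius_iff_coradFilt_finite :
    IsCoFrobenius k H ↔ ∃ n : ℕ, coradFilt k H n = ⊤ := by
  refine ⟨fun h => ?_, fun ⟨n, hn⟩ => isCoFrobenius_of_coradFilt_eq_top hn⟩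
  obtain ⟨m, u, r, p, hu, hr, hp⟩ := h.exists_isEquivariant
  exact ⟨_, coradFilt_eq_top_of_coradMapsTo fun m' c hc => hr.coradMapsTo hu hp hc⟩
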